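/- Let A = [a_{ij}] ∈ SO_3(ℝ) and let i, j, k be distinct indices in {1,2,3}. Then (a_{jj} + a_{kk})(a_{jk} + a_{kj}) = -(a_{ij} a_{ik} + a_{ji} a_{ki}). -/

import Mathlib

open Matrix

theorem SO3_identity_two (A : Matrix (Fin 3) (Fin 3) ℝ)
    (horth : Aᵀ * A = 1) (hdet : A.det = 1)
    (i j k : Fin 3) (hij : i ≠ j) (hik : i ≠ k) (hjk : j ≠ k) :
    (A j j + A k k) * (A j k + A k j) = -(A i j * A i k + A j i * A k i) := by
  have hrow : A * Aᵀ = 1 := mul_eq_one_comm.mp horth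
  have hsum (f : Fin 3 → ℝ) : ∑ l, f l = f i + f j + f k := by
    have huniv : (Finset.univ : Finset (Fin 3)) = {i, j, k} := by
      symm
      rw [← Finset.card_eq_iff_eq_univ, Finset.card_eq_three.mpr ⟨i, j, k, hij, hik, hjk, rfl⟩,
        Fintype.card_fin]
    rw [huniv, Finset.sum_insert (by simp [hij, hik]), Finset.sum_pair hjk, add_assoc]
  have hcol_jk := congrFun₂ horth j k
  have hrow_jk := congrFun₂ hrow j k
  simp only [mul_apply, transpose_apply, hsum, one_apply_ne hjk] at hcol_jk hrow_jk
  linear_combination hcol_jk + hrow_jk
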